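/- Every 2-local derivation of the algebra S₂ is a derivation (in particular, it is linear). -/

import Mathlib

set_option maxSynthPendingDepth 3

/-- The 2-dimensional vector space `V₂ = F²`, with standard basis `v₁ = (1,0)`, `v₂ = (0,1)`. -/
abbrev V2 (F : Type*) [Field F] := Fin 2 → F

/-- The fixed vector `v₁` (the first standard basis vector of `V₂`). -/
noncomputable def v1 (F : Type*) [Field F] : V2 F := Pi.single 0 1

/-- `W(2)`: the space of all bilinear multiplications on `V₂`. -/
abbrev Wtwo (F : Type*) [Field F] := V2 F →ₗ[F] V2 F →ₗ[F] V2 F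

variable {F : Type*} [Field F]

/-- The Kantor product on `W(2)`:
`(A·B)(x,y) = A(v₁, B(x,y)) − B(A(v₁,x), y) − B(x, A(v₁,y))`. -/
noncomputable def wmul (A B : Wtwo F) : Wtwo F :=
  LinearMap.mk₂ F
    (fun x y => A (v1 F) (B x y) - B (A (v1 F) x) y - B x (A (v1 F) y))
    (fun x x' y => by simp only [map_add, LinearMap.add_apply]; abel)
    (fun c x y => by simp only [map_smul, LinearMap.smul_apply, smul_sub])
    (fun x y y' => by simp only [map_add, LinearMap.add_apply]; abel)
    (fun c x y => by simp only [map_smul, LinearMap.smul_apply, smul_sub])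

/-- The multiplication `α^k_{i,j}` determined by `α^k_{i,j}(v_t, v_l) = δ_{it} δ_{jl} v_k`
(indices `0, 1` correspond to `1, 2` in the paper). -/
noncomputable def alph (k i j : Fin 2) : Wtwo F :=
  LinearMap.mk₂ F
    (fun x y => (x i * y j) • (Pi.single k 1 : V2 F))
    (fun x x' y => by simp [add_mul, add_smul])
    (fun c x y => by simp [smul_smul, mul_assoc])
    (fun x y y' => by simp [mul_add, add_smul])
    (fun c x y => by simp [smul_smul]; ring_nf)

noncomputable def e1 (F : Type*) [Field F] : Wtwo F := alph 0 0 0 - alph 1 0 1 - alph 1 1 0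

noncomputable def e2 (F : Type*) [Field F] : Wtwo F := alph 1 0 0

noncomputable def e3 (F : Type*) [Field F] : Wtwo F := alph 1 1 1 - alph 0 0 1 - alph 0 1 0

noncomputable def e4 (F : Type*) [Field F] : Wtwo F := alph 0 1 1


theorem wmul_add_left (A A' B : Wtwo F) : wmul (A + A') B = wmul A B + wmul A' B := by
  apply LinearMap.ext; intro x; apply LinearMap.ext; intro y
  simp [wmul]; abel

theorem wmul_smul_left (c : F) (A B : Wtwo F) : wmul (c • A) B = c • wmul A B := by
  apply LinearMap.ext; intro x; apply LinearMap.ext; intro y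
  simp [wmul, smul_sub]

theorem wmul_add_right (A B B' : Wtwo F) : wmul A (B + B') = wmul A B + wmul A B' := by
  apply LinearMap.ext; intro x; apply LinearMap.ext; intro y
  simp [wmul]; abel

theorem wmul_smul_right (c : F) (A B : Wtwo F) : wmul A (c • B) = c • wmul A B := by
  apply LinearMap.ext; intro x; apply LinearMap.ext; intro y
  simp [wmul, smul_sub]

theorem wmul_sub_left (A A' B : Wtwo F) : wmul (A - A') B = wmul A B - wmul A' B := by
  apply LinearMap.ext; intro x; apply LinearMap.ext; intro y
  simp [wmul]; abel

theorem wmul_sub_right (A B B' : Wtwo F) : wmul A (B - B') = wmul A B - wmul A B' := by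
  apply LinearMap.ext; intro x; apply LinearMap.ext; intro y
  simp [wmul]; abel

theorem wmul_alph (k i j k' i' j' : Fin 2) :
    wmul (alph k i j) (alph k' i' j' : Wtwo F) =
      (if i = 0 then (1:F) else 0) •
        ((if j = k' then (1:F) else 0) • alph k i' j'
          - (if k = i' then (1:F) else 0) • alph k' j j'
          - (if k = j' then (1:F) else 0) • alph k' i' j) := by
  apply LinearMap.ext; intro x; apply LinearMap.ext; intro y
  funext m
  simp [wmul, alph, v1, Pi.single_apply]
  split_ifs <;> simp_all <;> try ring

theorem mul_e4_left (B : Wtwo F) : wmul (e4 F) B = 0 := by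
  apply LinearMap.ext; intro x; apply LinearMap.ext; intro y
  simp [wmul, e4, alph, v1, Pi.single_apply]

theorem mul_e1_e1 : wmul (e1 F) (e1 F) = ((-1 : F)) • e1 F := by
  simp only [e1, e2, e3, e4, wmul_sub_left, wmul_sub_right, wmul_add_left, wmul_add_right,
    wmul_smul_left, wmul_smul_right, wmul_alph, Fin.reduceEq, reduceIte, one_smul, zero_smul,
    smul_zero, sub_zero, zero_sub, smul_sub, smul_add, smul_smul, neg_neg, smul_neg, neg_zero,
    sub_self, add_zero, zero_add]
  try module

theorem mul_e1_e2 : wmul (e1 F) (e2 F) = ((-3 : F)) • e2 F := by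
  simp only [e1, e2, e3, e4, wmul_sub_left, wmul_sub_right, wmul_add_left, wmul_add_right,
    wmul_smul_left, wmul_smul_right, wmul_alph, Fin.reduceEq, reduceIte, one_smul, zero_smul,
    smul_zero, sub_zero, zero_sub, smul_sub, smul_add, smul_smul, neg_neg, smul_neg, neg_zero,
    sub_self, add_zero, zero_add]
  try module

theorem mul_e1_e3 : wmul (e1 F) (e3 F) = ((1 : F)) • e3 F := by
  simp only [e1, e2, e3, e4, wmul_sub_left, wmul_sub_right, wmul_add_left, wmul_add_right,
    wmul_smul_left, wmul_smul_right, wmul_alph, Fin.reduceEq, reduceIte, one_smul, zero_smul,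
    smul_zero, sub_zero, zero_sub, smul_sub, smul_add, smul_smul, neg_neg, smul_neg, neg_zero,
    sub_self, add_zero, zero_add]
  try module

theorem mul_e1_e4 : wmul (e1 F) (e4 F) = ((3 : F)) • e4 F := by
  simp only [e1, e2, e3, e4, wmul_sub_left, wmul_sub_right, wmul_add_left, wmul_add_right,
    wmul_smul_left, wmul_smul_right, wmul_alph, Fin.reduceEq, reduceIte, one_smul, zero_smul,
    smul_zero, sub_zero, zero_sub, smul_sub, smul_add, smul_smul, neg_neg, smul_neg, neg_zero,
    sub_self, add_zero, zero_add]
  try module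

theorem mul_e2_e1 : wmul (e2 F) (e1 F) = ((3 : F)) • e2 F := by
  simp only [e1, e2, e3, e4, wmul_sub_left, wmul_sub_right, wmul_add_left, wmul_add_right,
    wmul_smul_left, wmul_smul_right, wmul_alph, Fin.reduceEq, reduceIte, one_smul, zero_smul,
    smul_zero, sub_zero, zero_sub, smul_sub, smul_add, smul_smul, neg_neg, smul_neg, neg_zero,
    sub_self, add_zero, zero_add]
  try module

theorem mul_e2_e2 : wmul (e2 F) (e2 F) = 0 := by
  simp only [e1, e2, e3, e4, wmul_sub_left, wmul_sub_right, wmul_add_left, wmul_add_right,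
    wmul_smul_left, wmul_smul_right, wmul_alph, Fin.reduceEq, reduceIte, one_smul, zero_smul,
    smul_zero, sub_zero, zero_sub, smul_sub, smul_add, smul_smul, neg_neg, smul_neg, neg_zero,
    sub_self, add_zero, zero_add]
  try module

theorem mul_e2_e3 : wmul (e2 F) (e3 F) = ((2 : F)) • e1 F := by
  simp only [e1, e2, e3, e4, wmul_sub_left, wmul_sub_right, wmul_add_left, wmul_add_right,
    wmul_smul_left, wmul_smul_right, wmul_alph, Fin.reduceEq, reduceIte, one_smul, zero_smul,
    smul_zero, sub_zero, zero_sub, smul_sub, smul_add, smul_smul, neg_neg, smul_neg, neg_zero,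
    sub_self, add_zero, zero_add]
  try module

theorem mul_e2_e4 : wmul (e2 F) (e4 F) = ((1 : F)) • e3 F := by
  simp only [e1, e2, e3, e4, wmul_sub_left, wmul_sub_right, wmul_add_left, wmul_add_right,
    wmul_smul_left, wmul_smul_right, wmul_alph, Fin.reduceEq, reduceIte, one_smul, zero_smul,
    smul_zero, sub_zero, zero_sub, smul_sub, smul_add, smul_smul, neg_neg, smul_neg, neg_zero,
    sub_self, add_zero, zero_add]
  try module

theorem mul_e3_e1 : wmul (e3 F) (e1 F) = ((-2 : F)) • e3 F := by
  simp only [e1, e2, e3, e4, wmul_sub_left, wmul_sub_right, wmul_add_left, wmul_add_right,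
    wmul_smul_left, wmul_smul_right, wmul_alph, Fin.reduceEq, reduceIte, one_smul, zero_smul,
    smul_zero, sub_zero, zero_sub, smul_sub, smul_add, smul_smul, neg_neg, smul_neg, neg_zero,
    sub_self, add_zero, zero_add]
  try module

theorem mul_e3_e2 : wmul (e3 F) (e2 F) = ((-1 : F)) • e1 F := by
  simp only [e1, e2, e3, e4, wmul_sub_left, wmul_sub_right, wmul_add_left, wmul_add_right,
    wmul_smul_left, wmul_smul_right, wmul_alph, Fin.reduceEq, reduceIte, one_smul, zero_smul,
    smul_zero, sub_zero, zero_sub, smul_sub, smul_add, smul_smul, neg_neg, smul_neg, neg_zero,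
    sub_self, add_zero, zero_add]
  try module

theorem mul_e3_e3 : wmul (e3 F) (e3 F) = ((-3 : F)) • e4 F := by
  simp only [e1, e2, e3, e4, wmul_sub_left, wmul_sub_right, wmul_add_left, wmul_add_right,
    wmul_smul_left, wmul_smul_right, wmul_alph, Fin.reduceEq, reduceIte, one_smul, zero_smul,
    smul_zero, sub_zero, zero_sub, smul_sub, smul_add, smul_smul, neg_neg, smul_neg, neg_zero,
    sub_self, add_zero, zero_add]
  try module

theorem mul_e3_e4 : wmul (e3 F) (e4 F) = 0 := by
  simp only [e1, e2, e3, e4, wmul_sub_left, wmul_sub_right, wmul_add_left, wmul_add_right,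
    wmul_smul_left, wmul_smul_right, wmul_alph, Fin.reduceEq, reduceIte, one_smul, zero_smul,
    smul_zero, sub_zero, zero_sub, smul_sub, smul_add, smul_smul, neg_neg, smul_neg, neg_zero,
    sub_self, add_zero, zero_add]
  try module

/-- `S2` as a subspace of `W(2)`. -/
noncomputable def S2 (F : Type*) [Field F] : Submodule F (Wtwo F) :=
  Submodule.span F {e1 F, e2 F, e3 F, e4 F}

/-- The Kantor product, as a bilinear map. -/
noncomputable def wmulL (F : Type*) [Field F] : Wtwo F →ₗ[F] Wtwo F →ₗ[F] Wtwo F :=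
  LinearMap.mk₂ F wmul wmul_add_left wmul_smul_left wmul_add_right wmul_smul_right

theorem S2_mul_mem {x y : Wtwo F} (hx : x ∈ S2 F) (hy : y ∈ S2 F) :
    wmul x y ∈ S2 F := by
  have h2 : Submodule.map₂ (wmulL F) (S2 F) (S2 F) ≤ S2 F := by
    rw [S2, Submodule.map₂_span_span, Submodule.span_le]
    rintro z ⟨a, ha, b, hb, rfl⟩
    simp only [Set.mem_insert_iff, Set.mem_singleton_iff] at ha hb
    rcases ha with rfl | rfl | rfl | rfl <;> rcases hb with rfl | rfl | rfl | rfl <;>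
      simp only [wmulL, LinearMap.mk₂_apply, mul_e1_e1, mul_e1_e2, mul_e1_e3, mul_e1_e4, mul_e2_e1, mul_e2_e2, mul_e2_e3, mul_e2_e4, mul_e3_e1, mul_e3_e2, mul_e3_e3, mul_e3_e4, mul_e4_left] <;>
      first
        | exact Submodule.zero_mem _
        | exact Submodule.smul_mem _ _ (Submodule.subset_span (by simp))
        | exact Submodule.subset_span (by simp)
  exact h2 (Submodule.apply_mem_map₂ _ hx hy)

/-- The product on `S2` (the Kantor product, which leaves `S2` invariant). -/
noncomputable def S2mul (x y : S2 F) : S2 F :=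
  ⟨wmul x y, S2_mul_mem x.2 y.2⟩

/-- A derivation of the algebra `S2`. -/
def IsDerivationS2 (D : S2 F →ₗ[F] S2 F) : Prop :=
  ∀ x y : S2 F, D (S2mul x y) = S2mul (D x) y + S2mul x (D y)

theorem exists_coords_of_mem_S2 {u : Wtwo F} (hu : u ∈ S2 F) :
    ∃ a b c d : F, u = a • e1 F + b • e2 F + c • e3 F + d • e4 F := by
  simp only [S2, Submodule.mem_span_insert, Submodule.mem_span_singleton] at hu
  obtain ⟨a, _, ⟨b, _, ⟨c, _, ⟨d, rfl⟩, rfl⟩, rfl⟩, rfl⟩ := hu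
  exact ⟨a, b, c, d, by abel⟩

theorem coords_eq_zero {a b c d : F}
    (h : a • e1 F + b • e2 F + c • e3 F + d • e4 F = 0) :
    a = 0 ∧ b = 0 ∧ c = 0 ∧ d = 0 := by
  have key : ∀ i j k : Fin 2,
      (a • e1 F + b • e2 F + c • e3 F + d • e4 F) (Pi.single i 1) (Pi.single j 1) k = 0 := by
    intro i j k
    simp [h]
  refine ⟨?_, ?_, ?_, ?_⟩
  · simpa [e1, e2, e3, e4, alph] using key 0 0 0
  · simpa [e1, e2, e3, e4, alph] using key 0 0 1
  · simpa [e1, e2, e3, e4, alph] using key 1 1 1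
  · simpa [e1, e2, e3, e4, alph] using key 1 1 0

theorem e1_mem_S2 : e1 F ∈ S2 F := Submodule.subset_span (by simp)

theorem e2_mem_S2 : e2 F ∈ S2 F := Submodule.subset_span (by simp)

theorem e3_mem_S2 : e3 F ∈ S2 F := Submodule.subset_span (by simp)

theorem e4_mem_S2 : e4 F ∈ S2 F := Submodule.subset_span (by simp)

/-- Inside `S2`, the right annihilator of `e2` is the line spanned by `e2`. -/
theorem exists_eq_smul_e2_of_mul_e2_eq_zero [CharZero F] {u : Wtwo F} (hu : u ∈ S2 F)
    (h : wmul (e2 F) u = 0) : ∃ b : F, u = b • e2 F := by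
  obtain ⟨a, b, c, d, rfl⟩ := exists_coords_of_mem_S2 hu
  simp only [wmul_add_right, wmul_smul_right, mul_e2_e1, mul_e2_e2, mul_e2_e3, mul_e2_e4] at h
  have h' : (2 * c) • e1 F + (3 * a) • e2 F + d • e3 F + (0 : F) • e4 F = 0 := by
    rw [← h]
    module
  obtain ⟨hc, ha, hd, -⟩ := coords_eq_zero h'
  have hc' : c = 0 := by simpa using hc
  have ha' : a = 0 := by simpa using ha
  exact ⟨b, by simp [ha', hc', hd]⟩

theorem smul_e2_eq_zero {b : F} (h : b • e2 F = 0) : b = 0 :=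
  (coords_eq_zero (a := 0) (b := b) (c := 0) (d := 0) (by simp [h])).2.1

theorem IsDerivationS2.sub {D D' : S2 F →ₗ[F] S2 F} (hD : IsDerivationS2 D)
    (hD' : IsDerivationS2 D') : IsDerivationS2 (D - D') := by
  intro x y
  apply Subtype.ext
  simp only [LinearMap.sub_apply, hD x y, hD' x y]
  simp only [S2mul, Submodule.coe_add, Submodule.coe_sub, wmul_sub_left, wmul_sub_right]
  abel

/-- A derivation of `S2` that kills `e2` is zero. -/
theorem IsDerivationS2.eq_zero_of_apply_e2 [CharZero F] {D : S2 F →ₗ[F] S2 F}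
    (hD : IsDerivationS2 D) (h2 : D ⟨e2 F, e2_mem_S2⟩ = 0) : D = 0 := by
  have leibniz {x y z : Wtwo F} (hx : x ∈ S2 F) (hy : y ∈ S2 F) (hz : z ∈ S2 F) {c : F}
      (h : wmul x y = c • z) :
      c • (D ⟨z, hz⟩ : Wtwo F) = wmul (D ⟨x, hx⟩) y + wmul x (D ⟨y, hy⟩) := by
    have hxy : S2mul ⟨x, hx⟩ ⟨y, hy⟩ = c • ⟨z, hz⟩ := Subtype.ext h
    have := congrArg Subtype.val (hD ⟨x, hx⟩ ⟨y, hy⟩)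
    rw [hxy, map_smul] at this
    exact this
  have zero_left (B : Wtwo F) : wmul 0 B = 0 := by simpa using wmul_smul_left 0 0 B
  have zero_right (A : Wtwo F) : wmul A 0 = 0 := by simpa using wmul_smul_right 0 A 0
  have h2' : (D ⟨e2 F, e2_mem_S2⟩ : Wtwo F) = 0 := by simp [h2]
  have h1 : (D ⟨e1 F, e1_mem_S2⟩ : Wtwo F) = 0 := by
    have h := leibniz e2_mem_S2 e1_mem_S2 e2_mem_S2 mul_e2_e1
    rw [h2', zero_left, smul_zero, zero_add] at h
    obtain ⟨b, hb⟩ := exists_eq_smul_e2_of_mul_e2_eq_zero (D _).2 h.symm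
    have h := leibniz e1_mem_S2 e1_mem_S2 e1_mem_S2 mul_e1_e1
    rw [hb, wmul_smul_left, wmul_smul_right, mul_e2_e1, mul_e1_e2] at h
    have hb0 : b • e2 F = 0 := by linear_combination (norm := module) (-1 : F) • h
    rw [hb, hb0]
  have h3 : (D ⟨e3 F, e3_mem_S2⟩ : Wtwo F) = 0 := by
    have h := leibniz e2_mem_S2 e3_mem_S2 e1_mem_S2 mul_e2_e3
    rw [h1, h2', zero_left, smul_zero, zero_add] at h
    obtain ⟨b, hb⟩ := exists_eq_smul_e2_of_mul_e2_eq_zero (D _).2 h.symm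
    have h := leibniz e1_mem_S2 e3_mem_S2 e3_mem_S2 mul_e1_e3
    rw [h1, hb, zero_left, wmul_smul_right, mul_e1_e2] at h
    have hb4 : (4 * b) • e2 F = 0 := by linear_combination (norm := module) h
    have hb0 : b = 0 := by simpa using smul_e2_eq_zero hb4
    rw [hb, hb0, zero_smul]
  have h4 : (D ⟨e4 F, e4_mem_S2⟩ : Wtwo F) = 0 := by
    have h := leibniz e3_mem_S2 e3_mem_S2 e4_mem_S2 mul_e3_e3
    rw [h3, zero_left, zero_right, add_zero] at h
    exact (smul_eq_zero.mp h).resolve_left (by norm_num)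
  ext1 ⟨x, hx⟩
  obtain ⟨a, b, c, d, rfl⟩ := exists_coords_of_mem_S2 hx
  have hsum : (⟨a • e1 F + b • e2 F + c • e3 F + d • e4 F, hx⟩ : S2 F) =
      a • ⟨e1 F, e1_mem_S2⟩ + b • ⟨e2 F, e2_mem_S2⟩ + c • ⟨e3 F, e3_mem_S2⟩
        + d • ⟨e4 F, e4_mem_S2⟩ := rfl
  rw [hsum, map_add, map_add, map_add, map_smul, map_smul, map_smul, map_smul,
    Submodule.coe_eq_zero.mp h1, h2, Submodule.coe_eq_zero.mp h3, Submodule.coe_eq_zero.mp h4]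
  simp

/-- Every 2-local derivation of the algebra `S2` is a derivation
(in particular, it is linear). -/
theorem every_twoLocalDerivation_isDerivation_S2 {F : Type*} [Field F] [CharZero F]
    (Δ : S2 F → S2 F)
    (hΔ : ∀ x y : S2 F, ∃ D : S2 F →ₗ[F] S2 F,
      IsDerivationS2 D ∧ Δ x = D x ∧ Δ y = D y) :
    ∃ D : S2 F →ₗ[F] S2 F, IsDerivationS2 D ∧ ∀ z : S2 F, Δ z = D z := by
  obtain ⟨D, hD, hD2, -⟩ := hΔ ⟨e2 F, e2_mem_S2⟩ ⟨e2 F, e2_mem_S2⟩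
  refine ⟨D, hD, fun z => ?_⟩
  obtain ⟨D', hD', hD2', hz⟩ := hΔ ⟨e2 F, e2_mem_S2⟩ z
  have h : D' = D := sub_eq_zero.mp <| (hD'.sub hD).eq_zero_of_apply_e2 (by
    rw [LinearMap.sub_apply, ← hD2, ← hD2', sub_self])
  rw [hz, h]
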